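/- Let N ≥ 4 and let W : ℝ^N → ℝ be locally integrable, even (W(−x) = W(x) for a.e. x), not almost everywhere zero, and satisfy condition (W_N). Then W ∈ M_{N/(N−2),2}(ℝ^N), W ∈ M_{N/(N−2),N/2}(ℝ^N) and W ∈ M_{2,N/2}(ℝ^N). -/

import Mathlib

open MeasureTheory Filter Complex SchwartzMap Metric
open scoped ENNReal Topology ComplexConjugate

noncomputable section

/-- Convolution of a real kernel with a complex-valued function. -/
def convW {N : ℕ} (W : (Fin N → ℝ) → ℝ) (f : (Fin N → ℝ) → ℂ) (x : Fin N → ℝ) : ℂ :=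
  ∫ y, (W (x - y) : ℂ) * f y

/-- `W ∈ M_{p,q}(ℝ^N)` with constant `K`: for every Schwartz function `f` the convolution
`W∗f` converges absolutely a.e. and `‖W∗f‖_{L^q} ≤ K ‖f‖_{L^p}`. -/
def MemMwith {N : ℕ} (W : (Fin N → ℝ) → ℝ) (p q : ℝ≥0∞) (K : ℝ) : Prop :=
  ∀ f : SchwartzMap (Fin N → ℝ) ℂ,
    (∀ᵐ x : Fin N → ℝ, Integrable (fun y => (W (x - y) : ℂ) * f y) volume) ∧
    eLpNorm (convW W ⇑f) q volume ≤ ENNReal.ofReal K * eLpNorm (⇑f) p volume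

/-- `W ∈ M_{p,q}(ℝ^N)`. -/
def MemM {N : ℕ} (W : (Fin N → ℝ) → ℝ) (p q : ℝ≥0∞) : Prop :=
  ∃ K : ℝ, 0 ≤ K ∧ MemMwith W p q K

/-- Condition `(W_N)` with a given choice of exponents. -/
def CondWnAt {N : ℕ} (W : (Fin N → ℝ) → ℝ)
    (p₁ p₂ p₃ p₄ q₁ q₂ q₃ q₄ s₁ s₂ : ℝ) : Prop :=
  1 ≤ p₁ ∧ 1 ≤ p₂ ∧ 1 ≤ p₃ ∧ 1 ≤ p₄ ∧ 1 ≤ q₁ ∧ 1 ≤ q₂ ∧ 1 ≤ q₃ ∧ 1 ≤ q₄ ∧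
  1 ≤ s₁ ∧ 1 ≤ s₂ ∧
  (3 ≤ N →
    p₄ < (N : ℝ) / ((N : ℝ) - 2) ∧
    2 ≤ p₂ ∧ p₂ < 2 * (N : ℝ) / ((N : ℝ) - 2) ∧
    2 ≤ p₃ ∧ p₃ < 2 * (N : ℝ) / ((N : ℝ) - 2) ∧
    2 ≤ s₁ ∧ s₁ < 2 * (N : ℝ) / ((N : ℝ) - 2) ∧
    2 ≤ s₂ ∧ s₂ < 2 * (N : ℝ) / ((N : ℝ) - 2) ∧
    2 * (N : ℝ) / ((N : ℝ) + 2) < q₁ ∧ q₁ ≤ 2 ∧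
    (N : ℝ) / 2 < q₃ ∧ (N : ℝ) / 2 < q₄) ∧
  (N ≤ 2 → 2 ≤ p₂ ∧ 2 ≤ p₃ ∧ 2 ≤ s₁ ∧ 2 ≤ s₂ ∧ 1 < q₁ ∧ q₁ ≤ 2) ∧
  MemM W 2 2 ∧
  MemM W (ENNReal.ofReal p₁) (ENNReal.ofReal q₁) ∧
  MemM W (ENNReal.ofReal p₂) (ENNReal.ofReal q₂) ∧
  MemM W (ENNReal.ofReal p₃) (ENNReal.ofReal q₃) ∧
  MemM W (ENNReal.ofReal p₄) (ENNReal.ofReal q₄) ∧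
  1 / p₃ + 1 / q₂ = 1 / q₁ ∧ 1 / p₁ - 1 / p₃ = 1 / s₁ ∧ 1 / q₁ - 1 / q₃ = 1 / s₂

/-- Condition `(W_N)`. -/
def CondWn {N : ℕ} (W : (Fin N → ℝ) → ℝ) : Prop :=
  ∃ p₁ p₂ p₃ p₄ q₁ q₂ q₃ q₄ s₁ s₂ : ℝ, CondWnAt W p₁ p₂ p₃ p₄ q₁ q₂ q₃ q₄ s₁ s₂

/-- `f` is measurable, bounded by `C` and vanishes outside the closed ball of radius `R`. -/
structure IsBddSupp {N : ℕ} (C R : ℝ) (f : (Fin N → ℝ) → ℂ) : Prop where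
  measurable : Measurable f
  norm_le : ∀ x, ‖f x‖ ≤ C
  eq_zero : ∀ x, R < ‖x‖ → f x = 0

/-- The bilinear form `∫∫ W (x - y) f(y) g(x)`. -/
def kernelForm {N : ℕ} (W : (Fin N → ℝ) → ℝ) (f g : (Fin N → ℝ) → ℂ) : ℂ :=
  ∫ z : (Fin N → ℝ) × (Fin N → ℝ), (W (z.1 - z.2) : ℂ) * f z.2 * g z.1

namespace IsBddSupp

variable {N : ℕ} {C R : ℝ} {f : (Fin N → ℝ) → ℂ}

lemma nonneg (hf : IsBddSupp C R f) : 0 ≤ C := (norm_nonneg _).trans (hf.norm_le 0)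

lemma norm_le_indicator (hf : IsBddSupp C R f) (x : Fin N → ℝ) :
    ‖f x‖ ≤ (closedBall (0 : Fin N → ℝ) R).indicator (fun _ => C) x := by
  by_cases hx : x ∈ closedBall (0 : Fin N → ℝ) R
  · simpa [hx] using hf.norm_le x
  · rw [Set.indicator_of_notMem hx, hf.eq_zero x (by simpa using hx), norm_zero]

lemma integrable_indicator_const (R C : ℝ) :
    Integrable ((closedBall (0 : Fin N → ℝ) R).indicator (fun _ => C)) := by
  rw [integrable_indicator_iff measurableSet_closedBall]
  exact integrableOn_const measure_closedBall_lt_top.ne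

lemma integrable (hf : IsBddSupp C R f) : Integrable f :=
  (integrable_indicator_const R C).mono' hf.measurable.aestronglyMeasurable
    (.of_forall hf.norm_le_indicator)

lemma memLp_top (hf : IsBddSupp C R f) : MemLp f ∞ :=
  memLp_top_of_bound hf.measurable.aestronglyMeasurable C (.of_forall hf.norm_le)

lemma memLp (hf : IsBddSupp C R f) (p : ℝ≥0∞) : MemLp f p :=
  hf.memLp_top.mono_exponent_of_measure_support_ne_top
    (fun x hx => hf.eq_zero x (by simpa using hx))
    (measure_closedBall_lt_top (x := (0 : Fin N → ℝ)) (r := R)).ne le_top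

lemma rpow_norm_le_indicator (hf : IsBddSupp C R f) {p : ℝ} (hp : 0 < p) (x : Fin N → ℝ) :
    ‖‖f x‖ ^ p‖ ≤ (closedBall (0 : Fin N → ℝ) R).indicator (fun _ => C ^ p) x := by
  rw [Real.norm_of_nonneg (by positivity)]
  by_cases hx : x ∈ closedBall (0 : Fin N → ℝ) R
  · simpa [hx] using Real.rpow_le_rpow (norm_nonneg _) (hf.norm_le x) hp.le
  · rw [Set.indicator_of_notMem hx, hf.eq_zero x (by simpa using hx), norm_zero,
      Real.zero_rpow hp.ne']

lemma indicator_const (R C : ℝ) (hC : 0 ≤ C) : IsBddSupp C R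
    ((closedBall (0 : Fin N → ℝ) R).indicator (fun _ => (C : ℂ))) where
  measurable := measurable_const.indicator measurableSet_closedBall
  norm_le x := by
    refine (norm_indicator_le_norm_self _ _).trans ?_
    simp [abs_of_nonneg hC]
  eq_zero x hx := Set.indicator_of_notMem (by simpa using hx) _

lemma tendsto_integral_rpow_norm {F : ℕ → (Fin N → ℝ) → ℂ} (hF : ∀ n, IsBddSupp C R (F n))
    (hlim : ∀ᵐ x : Fin N → ℝ, Tendsto (fun n => F n x) atTop (𝓝 (f x))) {p : ℝ} (hp : 0 < p) :
    Tendsto (fun n => ∫ x, ‖F n x‖ ^ p) atTop (𝓝 (∫ x, ‖f x‖ ^ p)) := by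
  refine tendsto_integral_of_dominated_convergence _
    (fun n => ((hF n).measurable.norm.pow_const p).aestronglyMeasurable)
    (integrable_indicator_const R (C ^ p))
    (fun n => .of_forall ((hF n).rpow_norm_le_indicator hp)) ?_
  filter_upwards [hlim] with x hx
  exact hx.norm.rpow_const (.inr hp.le)

lemma eLpNorm_eq (hf : IsBddSupp C R f) {p : ℝ} (hp : 0 < p) :
    eLpNorm f (ENNReal.ofReal p) = ENNReal.ofReal ((∫ x, ‖f x‖ ^ p) ^ p⁻¹) := by
  rw [(hf.memLp _).eLpNorm_eq_integral_rpow_norm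
    (by simpa using hp) ENNReal.ofReal_ne_top,
    ENNReal.toReal_ofReal hp.le]

end IsBddSupp

section Kernel

variable {N : ℕ} {W : (Fin N → ℝ) → ℝ} {C R C' R' : ℝ} {f g : (Fin N → ℝ) → ℂ}

lemma integrable_kernel (hW : LocallyIntegrable W volume) (hf : IsBddSupp C R f)
    (hg : IsBddSupp C' R' g) : Integrable (fun z : (Fin N → ℝ) × (Fin N → ℝ) =>
      (W (z.1 - z.2) : ℂ) * f z.2 * g z.1) := by
  have hV : Integrable ((closedBall (0 : Fin N → ℝ) (R + R')).indicator fun x => (W x : ℂ)) :=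
    (integrable_indicator_iff measurableSet_closedBall).2
      (hW.integrableOn_isCompact (isCompact_closedBall _ _)).ofReal
  have h := (hf.integrable.convolution_integrand (ContinuousLinearMap.mul ℝ ℂ) hV).mul_bdd (c := C')
    (hg.measurable.comp measurable_fst).aestronglyMeasurable (.of_forall fun z => hg.norm_le z.1)
  refine h.congr (.of_forall fun z => ?_)
  simp only [ContinuousLinearMap.mul_apply', Function.comp_apply]
  by_cases h1 : R < ‖z.2‖
  · simp [hf.eq_zero _ h1]
  by_cases h2 : R' < ‖z.1‖
  · simp [hg.eq_zero _ h2]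
  rw [Set.indicator_of_mem, mul_comm (f z.2)]
  simp only [mem_closedBall, dist_zero_right]
  linarith [norm_sub_le z.1 z.2]

lemma kernelForm_eq_integral_convW (hW : LocallyIntegrable W volume) (hf : IsBddSupp C R f)
    (hg : IsBddSupp C' R' g) : kernelForm W f g = ∫ x, convW W f x * g x := by
  rw [kernelForm, Measure.volume_eq_prod, integral_prod _ (integrable_kernel hW hf hg)]
  simp only [convW, integral_mul_const]

lemma tendsto_kernelForm (hW : LocallyIntegrable W volume) {F G : ℕ → (Fin N → ℝ) → ℂ}
    (hF : ∀ n, IsBddSupp C R (F n)) (hG : ∀ n, IsBddSupp C' R' (G n))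
    (hFf : ∀ᵐ x : Fin N → ℝ, Tendsto (fun n => F n x) atTop (𝓝 (f x)))
    (hGg : ∀ᵐ x : Fin N → ℝ, Tendsto (fun n => G n x) atTop (𝓝 (g x))) :
    Tendsto (fun n => kernelForm W (F n) (G n)) atTop (𝓝 (kernelForm W f g)) := by
  have hC := (hF 0).nonneg
  have hC' := (hG 0).nonneg
  refine tendsto_integral_of_dominated_convergence _
    (fun n => (integrable_kernel hW (hF n) (hG n)).aestronglyMeasurable)
    (integrable_kernel hW (.indicator_const R C hC) (.indicator_const R' C' hC')).norm
    (fun n => .of_forall fun z => ?_) ?_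
  · have h1 := (hF n).norm_le_indicator z.2
    have h2 := (hG n).norm_le_indicator z.1
    have e1 : ‖(closedBall (0 : Fin N → ℝ) R).indicator (fun _ => (C : ℂ)) z.2‖ =
        (closedBall (0 : Fin N → ℝ) R).indicator (fun _ => C) z.2 := by
      rw [norm_indicator_eq_indicator_norm]; simp [abs_of_nonneg hC]
    have e2 : ‖(closedBall (0 : Fin N → ℝ) R').indicator (fun _ => (C' : ℂ)) z.1‖ =
        (closedBall (0 : Fin N → ℝ) R').indicator (fun _ => C') z.1 := by
      rw [norm_indicator_eq_indicator_norm]; simp [abs_of_nonneg hC']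
    rw [norm_mul, norm_mul, norm_mul, norm_mul, e1, e2]
    gcongr
    exact mul_nonneg (norm_nonneg _) ((norm_nonneg _).trans h1)
  · filter_upwards [Measure.quasiMeasurePreserving_fst.ae hGg,
      Measure.quasiMeasurePreserving_snd.ae hFf] with z h1 h2
    exact (h2.const_mul _).mul h1

lemma kernelForm_comm (hWeven : ∀ᵐ x : Fin N → ℝ, W (-x) = W x) (f g : (Fin N → ℝ) → ℂ) :
    kernelForm W f g = kernelForm W g f := by
  rw [kernelForm, kernelForm, Measure.volume_eq_prod, ← integral_prod_swap]
  refine integral_congr_ae ?_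
  filter_upwards [(quasiMeasurePreserving_sub_of_right_invariant volume volume).ae hWeven] with z hz
  simp only [Prod.fst_swap, Prod.snd_swap]
  rw [← hz, neg_sub]
  ring

end Kernel

lemma IsBddSupp.exists_schwartzMap_tendsto {N : ℕ} {C R : ℝ} {f : (Fin N → ℝ) → ℂ}
    (hf : IsBddSupp C R f) : ∃ F : ℕ → SchwartzMap (Fin N → ℝ) ℂ,
      (∀ n, IsBddSupp C (R + 1) (F n)) ∧
      ∀ᵐ x : Fin N → ℝ, Tendsto (fun n => F n x) atTop (𝓝 (f x)) := by
  let φ : ℕ → ContDiffBump (0 : Fin N → ℝ) := fun n =>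
    { rIn := 1 / (2 * ((n : ℝ) + 1))
      rOut := 1 / ((n : ℝ) + 1)
      rIn_pos := by positivity
      rIn_lt_rOut := by
        apply one_div_lt_one_div_of_lt <;> nlinarith [(n.cast_nonneg : (0 : ℝ) ≤ n)] }
  have hrOut : ∀ n, (φ n).rOut ≤ 1 := fun n => by
    simp only [φ]
    rw [div_le_one (by positivity)]
    linarith [(n.cast_nonneg : (0 : ℝ) ≤ n)]
  let F : ℕ → (Fin N → ℝ) → ℂ := fun n =>
    convolution ((φ n).normed volume) f (ContinuousLinearMap.lsmul ℝ ℝ) volume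
  have hzero : ∀ n x, R + 1 < ‖x‖ → F n x = 0 := fun n x hx => by
    by_contra h
    obtain ⟨u, hu, v, hv, rfl⟩ := support_convolution_subset _ h
    rw [(φ n).support_normed_eq, mem_ball_zero_iff] at hu
    have hv' : ‖v‖ ≤ R := by
      by_contra! hlt
      exact hv (hf.eq_zero v hlt)
    linarith [norm_add_le u v, hrOut n]
  have hsmooth : ∀ n, ContDiff ℝ ((⊤ : ℕ∞) : WithTop ℕ∞) (F n) := fun n =>
    (φ n).hasCompactSupport_normed.contDiff_convolution_left _ (φ n).contDiff_normed
      hf.integrable.locallyIntegrable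
  have hcpt : ∀ n, HasCompactSupport (F n) := fun n =>
    HasCompactSupport.intro (isCompact_closedBall (0 : Fin N → ℝ) (R + 1))
      fun x hx => hzero n x (by simpa using hx)
  have hnorm : ∀ n x, ‖F n x‖ ≤ C := fun n x => by
    have hint : Integrable fun t => (φ n).normed volume t * C :=
      (φ n).integrable_normed.mul_const C
    calc ‖F n x‖ ≤ ∫ t, (φ n).normed volume t * C :=
          norm_integral_le_of_norm_le hint (.of_forall fun t => by
            simp only [ContinuousLinearMap.lsmul_apply, norm_smul,
              Real.norm_of_nonneg ((φ n).nonneg_normed t)]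
            exact mul_le_mul_of_nonneg_left (hf.norm_le _) ((φ n).nonneg_normed t))
      _ = C := by rw [integral_mul_const, (φ n).integral_normed, one_mul]
  refine ⟨fun n => (hcpt n).toSchwartzMap (hsmooth n),
    fun n => ⟨(hsmooth n).continuous.measurable, hnorm n, hzero n⟩, ?_⟩
  refine ContDiffBump.ae_convolution_tendsto_right_of_locallyIntegrable (φ := φ) (K := 2)
    tendsto_one_div_add_atTop_nhds_zero_nat (.of_forall fun n => ?_)
    hf.integrable.locallyIntegrable
  simp only [φ]
  rw [one_div, one_div, mul_inv, mul_inv_cancel_left₀ two_ne_zero]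

lemma aestronglyMeasurable_convW {N : ℕ} {W : (Fin N → ℝ) → ℝ}
    (hW : LocallyIntegrable W volume) {f : (Fin N → ℝ) → ℂ} (hf : Measurable f) :
    AEStronglyMeasurable (convW W f) volume := by
  have h : AEStronglyMeasurable (fun z : (Fin N → ℝ) × (Fin N → ℝ) =>
      (W (z.1 - z.2) : ℂ) * f z.2) (volume.prod volume) :=
    ((continuous_ofReal.comp_aestronglyMeasurable hW.aestronglyMeasurable).comp_quasiMeasurePreserving
      (quasiMeasurePreserving_sub_of_right_invariant volume volume)).mul
      (hf.comp measurable_snd).aestronglyMeasurable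
  exact h.integral_prod_right'

/-- The form `kernelForm W` is bounded on `L^{1/a} × L^{1/s}`, tested on bounded measurable
functions with bounded support. -/
def FormBdd {N : ℕ} (W : (Fin N → ℝ) → ℝ) (a s : ℝ) : Prop :=
  ∃ K : ℝ, 0 ≤ K ∧ ∀ (C R C' R' : ℝ) (f g : (Fin N → ℝ) → ℂ),
    IsBddSupp C R f → IsBddSupp C' R' g →
    ‖kernelForm W f g‖ ≤ K * (∫ x, ‖f x‖ ^ a⁻¹) ^ a * (∫ x, ‖g x‖ ^ s⁻¹) ^ s

lemma FormBdd.symm {N : ℕ} {W : (Fin N → ℝ) → ℝ} {a s : ℝ}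
    (hWeven : ∀ᵐ x : Fin N → ℝ, W (-x) = W x) (h : FormBdd W a s) : FormBdd W s a := by
  obtain ⟨K, hK, h⟩ := h
  refine ⟨K, hK, fun C R C' R' f g hf hg => ?_⟩
  rw [kernelForm_comm hWeven, mul_right_comm]
  exact h _ _ _ _ _ _ hg hf

lemma formBdd_of_memM {N : ℕ} {W : (Fin N → ℝ) → ℝ} (hW : LocallyIntegrable W volume) {p q : ℝ}
    (hp : 0 < p) (hq : 1 < q) (h : MemM W (ENNReal.ofReal p) (ENNReal.ofReal q)) :
    FormBdd W p⁻¹ (1 - q⁻¹) := by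
  obtain ⟨K, hK, h⟩ := h
  refine ⟨K, hK, fun C R C' R' f g hf hg => ?_⟩
  have hq0 : 0 < q := one_pos.trans hq
  set r := (1 - q⁻¹)⁻¹ with hr
  have hqr : q.HolderConjugate r := by
    rw [Real.holderConjugate_iff]
    exact ⟨hq, by rw [hr, inv_inv]; ring⟩
  have hs : (0 : ℝ) < 1 - q⁻¹ := sub_pos.2 (inv_lt_one_of_one_lt₀ hq)
  obtain ⟨F, hF, hlim⟩ := hf.exists_schwartzMap_tendsto
  have hbound : ∀ n, ‖kernelForm W (F n) g‖ ≤
      K * (∫ x, ‖F n x‖ ^ p) ^ p⁻¹ * (∫ x, ‖g x‖ ^ r) ^ (1 - q⁻¹) := fun n => by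
    have hle := (h (F n)).2
    rw [(hF n).eLpNorm_eq hp, ← ENNReal.ofReal_mul hK] at hle
    have hmem : MemLp (convW W (F n)) (ENNReal.ofReal q) :=
      ⟨aestronglyMeasurable_convW hW (hF n).measurable, hle.trans_lt ENNReal.ofReal_lt_top⟩
    rw [hmem.eLpNorm_eq_integral_rpow_norm (by simpa using hq0) ENNReal.ofReal_ne_top,
      ENNReal.toReal_ofReal hq0.le, ENNReal.ofReal_le_ofReal_iff (by positivity)] at hle
    rw [kernelForm_eq_integral_convW hW (hF n) hg]
    refine (norm_integral_le_integral_norm _).trans ?_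
    simp only [norm_mul]
    refine (integral_mul_norm_le_Lp_mul_Lq hqr hmem (hg.memLp _)).trans ?_
    rw [one_div, one_div, hr, inv_inv]
    gcongr
  rw [inv_inv]
  refine le_of_tendsto_of_tendsto
    (tendsto_kernelForm hW hF (fun _ => hg) hlim (.of_forall fun _ => tendsto_const_nhds)).norm
    (((IsBddSupp.tendsto_integral_rpow_norm hF hlim hp).rpow_const
      (.inr (inv_nonneg.2 hp.le))).const_mul K |>.mul_const _) (.of_forall hbound)

/-- The number with the argument of `w` and modulus `‖w‖ ^ c`. -/
def polarPow (c w : ℂ) : ℂ := if w = 0 then 0 else w / ‖w‖ * (‖w‖ : ℂ) ^ c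

lemma polarPow_one (w : ℂ) : polarPow 1 w = w := by
  by_cases hw : w = 0
  · simp [polarPow, hw]
  · have : (‖w‖ : ℂ) ≠ 0 := by simpa using hw
    simp [polarPow, hw, this]

lemma polarPow_zero_right (c : ℂ) : polarPow c 0 = 0 := if_pos rfl

lemma norm_polarPow {c : ℂ} (hc : 0 < c.re) (w : ℂ) : ‖polarPow c w‖ = ‖w‖ ^ c.re := by
  by_cases hw : w = 0
  · simp [polarPow, hw, Real.zero_rpow hc.ne']
  · have h : 0 < ‖w‖ := norm_pos_iff.2 hw
    simp [polarPow, hw, norm_cpow_eq_rpow_re_of_pos h, h.ne']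

lemma differentiable_polarPow (w : ℂ) : Differentiable ℂ fun c => polarPow c w := by
  by_cases hw : w = 0
  · simp [polarPow, hw]
  · have h : (‖w‖ : ℂ) ≠ 0 := by simpa using hw
    simp only [polarPow, hw, if_false]
    exact (differentiable_id.const_cpow (.inl h)).const_mul _

lemma norm_polarPow_le {c : ℂ} {M : ℝ} (hc : 0 < c.re) (hM : c.re ≤ M) (w : ℂ) :
    ‖polarPow c w‖ ≤ (1 + ‖w‖) ^ M := by
  rw [norm_polarPow hc]
  calc ‖w‖ ^ c.re ≤ (1 + ‖w‖) ^ c.re := by gcongr; linarith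
    _ ≤ (1 + ‖w‖) ^ M := Real.rpow_le_rpow_of_exponent_le (by linarith [norm_nonneg w]) hM

section SimpleFunctions

variable {N : ℕ} {C R C' R' : ℝ} {W : (Fin N → ℝ) → ℝ} {f g : SimpleFunc (Fin N → ℝ) ℂ}

lemma IsBddSupp.exists_map_polarPow (hf : IsBddSupp C R f) (c : ℂ) :
    ∃ D, IsBddSupp D R (f.map (polarPow c)) := by
  obtain ⟨D, hD⟩ := (f.map (polarPow c)).exists_forall_norm_le
  refine ⟨D, (f.map _).measurable, hD, fun x hx => ?_⟩
  simp [hf.eq_zero x hx, polarPow_zero_right]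

lemma IsBddSupp.polarPow_mul_indicator (hf : IsBddSupp C R f) (c u : ℂ) :
    IsBddSupp ‖polarPow c u‖ R
      (fun x => polarPow c u * (f ⁻¹' {u}).indicator (fun _ => 1) x) where
  measurable := (measurable_const.indicator (f.measurableSet_fiber u)).const_mul _
  norm_le x := by
    rw [norm_mul]
    refine mul_le_of_le_one_right (norm_nonneg _) ((norm_indicator_le_norm_self _ _).trans ?_)
    simp
  eq_zero x hx := by
    by_cases hu : f x = u
    · rw [← hu, hf.eq_zero x hx, polarPow_zero_right, zero_mul]
    · rw [Set.indicator_of_notMem (by simpa using hu), mul_zero]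

lemma map_polarPow_eq_sum (f : SimpleFunc (Fin N → ℝ) ℂ) (c : ℂ) (x : Fin N → ℝ) :
    f.map (polarPow c) x =
      ∑ u ∈ f.range, polarPow c u * (f ⁻¹' {u}).indicator (fun _ => 1) x := by
  rw [Finset.sum_eq_single_of_mem (f x) (f.mem_range_self x)]
  · simp
  · intro u _ hu
    rw [Set.indicator_of_notMem (by simpa using hu.symm), mul_zero]

lemma kernelForm_map_polarPow (hW : LocallyIntegrable W volume) (hf : IsBddSupp C R f)
    (hg : IsBddSupp C' R' g) (c d : ℂ) :
    kernelForm W (f.map (polarPow c)) (g.map (polarPow d)) =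
      ∑ u ∈ f.range, ∑ v ∈ g.range, polarPow c u * polarPow d v *
        kernelForm W ((f ⁻¹' {u}).indicator fun _ => 1) ((g ⁻¹' {v}).indicator fun _ => 1) := by
  have hint := fun u v => integrable_kernel hW (hf.polarPow_mul_indicator c u)
    (hg.polarPow_mul_indicator d v)
  simp only [kernelForm, map_polarPow_eq_sum, Finset.mul_sum, Finset.sum_mul]
  rw [Finset.sum_comm, integral_finsetSum _ fun v _ => integrable_finsetSum _ fun u _ => hint u v]
  refine Finset.sum_congr rfl fun v _ => ?_
  rw [integral_finsetSum _ fun u _ => hint u v]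
  refine Finset.sum_congr rfl fun u _ => ?_
  rw [← integral_const_mul]
  congr 1
  ext z
  ring

lemma integral_norm_map_polarPow_rpow (f : SimpleFunc (Fin N → ℝ) ℂ) {c : ℂ} (hc : 0 < c.re)
    (p : ℝ) : ∫ x, ‖f.map (polarPow c) x‖ ^ p = ∫ x, ‖f x‖ ^ (c.re * p) := by
  simp only [SimpleFunc.map_apply, norm_polarPow hc, ← Real.rpow_mul (norm_nonneg _)]

lemma re_interp (b₀ b₁ : ℝ) (z : ℂ) :
    ((1 - z) * b₀ + z * b₁).re = (1 - z.re) * b₀ + z.re * b₁ := by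
  simp

lemma interp_pos {b₀ b₁ t : ℝ} (h₀ : 0 < b₀) (h₁ : 0 < b₁) (ht : t ∈ Set.Icc (0 : ℝ) 1) :
    0 < (1 - t) * b₀ + t * b₁ := by
  rcases ht.1.eq_or_lt with rfl | h
  · simpa
  · nlinarith [mul_pos h h₁, mul_nonneg (sub_nonneg.2 ht.2) h₀.le]

lemma interp_le_add {b₀ b₁ t : ℝ} (h₀ : 0 < b₀) (h₁ : 0 < b₁) (ht : t ∈ Set.Icc (0 : ℝ) 1) :
    (1 - t) * b₀ + t * b₁ ≤ b₀ + b₁ := by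
  nlinarith [mul_nonneg ht.1 h₀.le, mul_nonneg (sub_nonneg.2 ht.2) h₁.le]

lemma bddAbove_kernelForm_map_polarPow (hW : LocallyIntegrable W volume) (hf : IsBddSupp C R f)
    (hg : IsBddSupp C' R' g) {b₀ b₁ d₀ d₁ : ℝ} (hb₀ : 0 < b₀) (hb₁ : 0 < b₁) (hd₀ : 0 < d₀)
    (hd₁ : 0 < d₁) : BddAbove ((norm ∘ fun z : ℂ =>
      kernelForm W (f.map (polarPow ((1 - z) * b₀ + z * b₁)))
        (g.map (polarPow ((1 - z) * d₀ + z * d₁)))) ''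
      HadamardThreeLines.verticalClosedStrip 0 1) := by
  refine ⟨∑ u ∈ f.range, ∑ v ∈ g.range, (1 + ‖u‖) ^ (b₀ + b₁) * (1 + ‖v‖) ^ (d₀ + d₁) *
    ‖kernelForm W ((f ⁻¹' {u}).indicator fun _ => 1) ((g ⁻¹' {v}).indicator fun _ => 1)‖, ?_⟩
  rintro _ ⟨z, hz, rfl⟩
  simp only [Function.comp_apply, kernelForm_map_polarPow hW hf hg]
  refine norm_sum_le_of_le _ fun u _ => norm_sum_le_of_le _ fun v _ => ?_
  rw [norm_mul, norm_mul]
  gcongr <;> apply norm_polarPow_le <;> rw [re_interp]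
  exacts [interp_pos hb₀ hb₁ hz, interp_le_add hb₀ hb₁ hz, interp_pos hd₀ hd₁ hz,
    interp_le_add hd₀ hd₁ hz]

lemma differentiable_kernelForm_map_polarPow (hW : LocallyIntegrable W volume)
    (hf : IsBddSupp C R f) (hg : IsBddSupp C' R' g) (b₀ b₁ d₀ d₁ : ℝ) :
    Differentiable ℂ fun z : ℂ => kernelForm W (f.map (polarPow ((1 - z) * b₀ + z * b₁)))
        (g.map (polarPow ((1 - z) * d₀ + z * d₁))) := by
  simp only [kernelForm_map_polarPow hW hf hg]
  have h : ∀ (e₀ e₁ : ℝ) (w : ℂ),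
      Differentiable ℂ fun z : ℂ => polarPow ((1 - z) * e₀ + z * e₁) w := fun e₀ e₁ w =>
    (differentiable_polarPow w).comp (by fun_prop)
  exact Differentiable.fun_sum fun u _ => Differentiable.fun_sum fun v _ =>
    ((h _ _ u).mul (h _ _ v)).mul_const _

lemma norm_kernelForm_le_interp (hW : LocallyIntegrable W volume) {a₀ a₁ s₀ s₁ t K₀ K₁ : ℝ}
    (ha₀ : 0 < a₀) (ha₁ : 0 < a₁) (hs₀ : 0 < s₀) (hs₁ : 0 < s₁) (ht : t ∈ Set.Icc (0 : ℝ) 1)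
    (hK₀ : 0 ≤ K₀) (hK₁ : 0 ≤ K₁)
    (h₀ : ∀ (C R C' R' : ℝ) (f g : (Fin N → ℝ) → ℂ), IsBddSupp C R f → IsBddSupp C' R' g →
      ‖kernelForm W f g‖ ≤ K₀ * (∫ x, ‖f x‖ ^ a₀⁻¹) ^ a₀ * (∫ x, ‖g x‖ ^ s₀⁻¹) ^ s₀)
    (h₁ : ∀ (C R C' R' : ℝ) (f g : (Fin N → ℝ) → ℂ), IsBddSupp C R f → IsBddSupp C' R' g →
      ‖kernelForm W f g‖ ≤ K₁ * (∫ x, ‖f x‖ ^ a₁⁻¹) ^ a₁ * (∫ x, ‖g x‖ ^ s₁⁻¹) ^ s₁)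
    (hf : IsBddSupp C R f) (hg : IsBddSupp C' R' g) :
    ‖kernelForm W f g‖ ≤ K₀ ^ (1 - t) * K₁ ^ t *
      (∫ x, ‖f x‖ ^ ((1 - t) * a₀ + t * a₁)⁻¹) ^ ((1 - t) * a₀ + t * a₁) *
      (∫ x, ‖g x‖ ^ ((1 - t) * s₀ + t * s₁)⁻¹) ^ ((1 - t) * s₀ + t * s₁) := by
  have ha := interp_pos ha₀ ha₁ ht
  have hs := interp_pos hs₀ hs₁ ht
  set a := (1 - t) * a₀ + t * a₁ with ha_def
  set s := (1 - t) * s₀ + t * s₁ with hs_def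
  set I := ∫ x, ‖f x‖ ^ a⁻¹
  set J := ∫ x, ‖g x‖ ^ s⁻¹
  have hI : 0 ≤ I := integral_nonneg fun x => by positivity
  have hJ : 0 ≤ J := integral_nonneg fun x => by positivity
  let Φ : ℂ → ℂ := fun z =>
    kernelForm W (f.map (polarPow ((1 - z) * (a₀ / a : ℝ) + z * (a₁ / a : ℝ))))
      (g.map (polarPow ((1 - z) * (s₀ / s : ℝ) + z * (s₁ / s : ℝ))))
  have hΦt : Φ t = kernelForm W f g := by
    have e₁ : (1 - (t : ℂ)) * (a₀ / a : ℝ) + t * (a₁ / a : ℝ) = 1 := by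
      norm_cast
      field_simp
      linarith
    have e₂ : (1 - (t : ℂ)) * (s₀ / s : ℝ) + t * (s₁ / s : ℝ) = 1 := by
      norm_cast
      field_simp
      linarith
    simp only [Φ, e₁, e₂, SimpleFunc.coe_map]
    congr 1 <;> ext x <;> simp [polarPow_one]
  have hmap : ∀ (F : SimpleFunc (Fin N → ℝ) ℂ) {c : ℂ} {b e : ℝ}, 0 < b → 0 < e →
      c.re = b / e → (∫ x, ‖F.map (polarPow c) x‖ ^ b⁻¹) = ∫ x, ‖F x‖ ^ e⁻¹ := by
    intro F c b e hb he hc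
    rw [integral_norm_map_polarPow_rpow F (by rw [hc]; positivity), hc]
    congr! 3
    field_simp
  have hleft : ∀ z ∈ re ⁻¹' {(0 : ℝ)}, ‖Φ z‖ ≤ K₀ * I ^ a₀ * J ^ s₀ := by
    intro z hz
    have hz : z.re = 0 := hz
    obtain ⟨D, hD⟩ := hf.exists_map_polarPow ((1 - z) * (a₀ / a : ℝ) + z * (a₁ / a : ℝ))
    obtain ⟨D', hD'⟩ := hg.exists_map_polarPow ((1 - z) * (s₀ / s : ℝ) + z * (s₁ / s : ℝ))
    have := h₀ _ _ _ _ _ _ hD hD'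
    rwa [hmap f ha₀ ha (by rw [re_interp, hz]; ring),
      hmap g hs₀ hs (by rw [re_interp, hz]; ring)] at this
  have hright : ∀ z ∈ re ⁻¹' {(1 : ℝ)}, ‖Φ z‖ ≤ K₁ * I ^ a₁ * J ^ s₁ := by
    intro z hz
    have hz : z.re = 1 := hz
    obtain ⟨D, hD⟩ := hf.exists_map_polarPow ((1 - z) * (a₀ / a : ℝ) + z * (a₁ / a : ℝ))
    obtain ⟨D', hD'⟩ := hg.exists_map_polarPow ((1 - z) * (s₀ / s : ℝ) + z * (s₁ / s : ℝ))
    have := h₁ _ _ _ _ _ _ hD hD'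
    rwa [hmap f ha₁ ha (by rw [re_interp, hz]; ring),
      hmap g hs₁ hs (by rw [re_interp, hz]; ring)] at this
  have key := HadamardThreeLines.norm_le_interp_of_mem_verticalClosedStrip₀₁' Φ (z := t)
    (by simpa [HadamardThreeLines.verticalClosedStrip] using ht)
    (differentiable_kernelForm_map_polarPow hW hf hg _ _ _ _).diffContOnCl
    (bddAbove_kernelForm_map_polarPow hW hf hg (by positivity) (by positivity) (by positivity)
      (by positivity)) hleft hright
  have h1t : 0 ≤ 1 - t := sub_nonneg.2 ht.2
  have hpow : ∀ {Q b₀ b₁ : ℝ}, 0 ≤ Q → 0 < b₀ → 0 < b₁ →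
      (Q ^ b₀) ^ (1 - t) * (Q ^ b₁) ^ t = Q ^ ((1 - t) * b₀ + t * b₁) := by
    intro Q b₀ b₁ hQ hb₀ hb₁
    rw [← Real.rpow_mul hQ, ← Real.rpow_mul hQ, ← Real.rpow_add_of_nonneg hQ
      (mul_nonneg hb₀.le h1t) (mul_nonneg hb₁.le ht.1), mul_comm b₀, mul_comm b₁]
  rw [hΦt, ofReal_re, Real.mul_rpow (by positivity) (by positivity),
    Real.mul_rpow hK₀ (by positivity), Real.mul_rpow (by positivity) (by positivity),
    Real.mul_rpow hK₁ (by positivity)] at key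
  rw [ha_def, hs_def, ← hpow hI ha₀ ha₁, ← hpow hJ hs₀ hs₁]
  refine key.trans_eq ?_
  ring

end SimpleFunctions

lemma IsBddSupp.exists_simpleFunc_tendsto {N : ℕ} {C R : ℝ} {f : (Fin N → ℝ) → ℂ}
    (hf : IsBddSupp C R f) : ∃ F : ℕ → SimpleFunc (Fin N → ℝ) ℂ,
      (∀ n, IsBddSupp C R (F n)) ∧ ∀ x, Tendsto (fun n => F n x) atTop (𝓝 (f x)) := by
  have hsm := hf.measurable.stronglyMeasurable
  have hF : ∀ n x, ((hsm.approxBounded C n).restrict (closedBall (0 : Fin N → ℝ) R)) x =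
      (closedBall (0 : Fin N → ℝ) R).indicator (hsm.approxBounded C n) x := fun n x => by
    rw [SimpleFunc.restrict_apply _ measurableSet_closedBall]
  refine ⟨fun n => (hsm.approxBounded C n).restrict (closedBall (0 : Fin N → ℝ) R),
    fun n => ⟨SimpleFunc.measurable _, fun x => ?_, fun x hx => ?_⟩, fun x => ?_⟩
  · rw [hF]
    exact (norm_indicator_le_norm_self _ _).trans (hsm.norm_approxBounded_le hf.nonneg n x)
  · rw [hF, Set.indicator_of_notMem (by simpa using hx)]
  · simp only [hF]
    by_cases hx : x ∈ closedBall (0 : Fin N → ℝ) R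
    · simpa only [Set.indicator_of_mem hx] using
        hsm.tendsto_approxBounded_of_norm_le (hf.norm_le x)
    · simp only [Set.indicator_of_notMem hx]
      rw [hf.eq_zero x (by simpa using hx)]
      exact tendsto_const_nhds

/-- Riesz–Thorin interpolation for the convolution form. -/
lemma FormBdd.interp {N : ℕ} {W : (Fin N → ℝ) → ℝ} (hW : LocallyIntegrable W volume)
    {a₀ a₁ s₀ s₁ t : ℝ} (ha₀ : 0 < a₀) (ha₁ : 0 < a₁) (hs₀ : 0 < s₀) (hs₁ : 0 < s₁)
    (ht : t ∈ Set.Icc (0 : ℝ) 1) (h₀ : FormBdd W a₀ s₀) (h₁ : FormBdd W a₁ s₁) :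
    FormBdd W ((1 - t) * a₀ + t * a₁) ((1 - t) * s₀ + t * s₁) := by
  obtain ⟨K₀, hK₀, h₀⟩ := h₀
  obtain ⟨K₁, hK₁, h₁⟩ := h₁
  have ha := interp_pos ha₀ ha₁ ht
  have hs := interp_pos hs₀ hs₁ ht
  refine ⟨K₀ ^ (1 - t) * K₁ ^ t, by positivity, fun C R C' R' f g hf hg => ?_⟩
  obtain ⟨F, hF, hFf⟩ := hf.exists_simpleFunc_tendsto
  obtain ⟨G, hG, hGg⟩ := hg.exists_simpleFunc_tendsto
  refine le_of_tendsto_of_tendsto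
    (tendsto_kernelForm hW hF hG (.of_forall hFf) (.of_forall hGg)).norm
    ((((IsBddSupp.tendsto_integral_rpow_norm hF (.of_forall hFf) (inv_pos.2 ha)).rpow_const
      (.inr ha.le)).const_mul _).mul
      ((IsBddSupp.tendsto_integral_rpow_norm hG (.of_forall hGg) (inv_pos.2 hs)).rpow_const
      (.inr hs.le)))
    (.of_forall fun n =>
      norm_kernelForm_le_interp hW ha₀ ha₁ hs₀ hs₁ ht hK₀ hK₁ h₀ h₁ (hF n) (hG n))

section Converse

variable {N : ℕ} {W : (Fin N → ℝ) → ℝ} {C R : ℝ} {f : (Fin N → ℝ) → ℂ}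

lemma eLpNorm_le_of_ae_tendsto {F : ℕ → (Fin N → ℝ) → ℂ} {p B : ℝ≥0∞}
    (hF : ∀ n, AEStronglyMeasurable (F n) volume) (hB : ∀ n, eLpNorm (F n) p ≤ B)
    (hlim : ∀ᵐ x : Fin N → ℝ, Tendsto (fun n => F n x) atTop (𝓝 (f x))) : eLpNorm f p ≤ B :=
  (Lp.eLpNorm_lim_le_liminf_eLpNorm hF f hlim).trans
    (liminf_le_of_le (by isBoundedDefault) fun _ hb =>
      let ⟨n, hn⟩ := hb.exists
      hn.trans (hB n))

lemma rpow_one_sub_le {J M s : ℝ} (hJ : 0 ≤ J) (hM : 0 ≤ M) (h : J ≤ M * J ^ s) (hs : s < 1) :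
    J ^ (1 - s) ≤ M := by
  rcases hJ.eq_or_lt with rfl | hJ
  · rwa [Real.zero_rpow (sub_pos.2 hs).ne']
  · rw [Real.rpow_sub hJ, Real.rpow_one]
    exact (div_le_iff₀ (by positivity)).2 h

/-- The dual function `conj h * ‖h‖ ^ (q - 2)` satisfies the equality case of Hölder. -/
lemma conj_mul_norm_rpow {q : ℝ} (hq : 1 < q) (w : ℂ) :
    w * (conj w * (‖w‖ ^ (q - 2) : ℝ)) = (‖w‖ ^ q : ℝ) ∧
      ‖conj w * (‖w‖ ^ (q - 2) : ℝ)‖ = ‖w‖ ^ (q - 1) := by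
  rcases eq_or_ne w 0 with rfl | hw
  · simp [Real.zero_rpow (by linarith : q ≠ 0), Real.zero_rpow (by linarith : q - 1 ≠ 0)]
  · have h : 0 < ‖w‖ := norm_pos_iff.2 hw
    constructor
    · rw [← mul_assoc, Complex.mul_conj, Complex.normSq_eq_norm_sq, ← ofReal_mul,
        ← Real.rpow_natCast, ← Real.rpow_add h]
      norm_num
    · rw [norm_mul, norm_conj, norm_real, Real.norm_of_nonneg (by positivity)]
      nth_rw 1 [← Real.rpow_one ‖w‖]
      rw [← Real.rpow_add h]
      ring_nf

lemma eLpNorm_le_of_forall_integral_mul_le {h : (Fin N → ℝ) → ℂ} (hh : Measurable h) {M s : ℝ}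
    (hM : 0 ≤ M) (hs₀ : 0 < s) (hs₁ : s < 1)
    (H : ∀ (C R : ℝ) (g : (Fin N → ℝ) → ℂ), IsBddSupp C R g →
      ‖∫ x, h x * g x‖ ≤ M * (∫ x, ‖g x‖ ^ s⁻¹) ^ s) :
    eLpNorm h (ENNReal.ofReal (1 - s)⁻¹) ≤ ENNReal.ofReal M := by
  set q := (1 - s)⁻¹ with hq_def
  have h1s : 0 < 1 - s := sub_pos.2 hs₁
  have hq : 1 < q := one_lt_inv_iff₀.2 ⟨h1s, by linarith⟩
  let S : ℕ → Set (Fin N → ℝ) := fun m => closedBall 0 m ∩ {x | ‖h x‖ ≤ m}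
  have hS : ∀ m, MeasurableSet (S m) := fun m =>
    measurableSet_closedBall.inter (measurableSet_le hh.norm measurable_const)
  let T : ℕ → (Fin N → ℝ) → ℂ := fun m => (S m).indicator h
  have hT : ∀ m : ℕ, IsBddSupp m m (T m) := fun m =>
    { measurable := hh.indicator (hS m)
      norm_le := fun x => by
        by_cases hx : x ∈ S m
        · simp only [T, Set.indicator_of_mem hx]
          exact hx.2
        · simp [T, Set.indicator_of_notMem hx]
      eq_zero := fun x hx => Set.indicator_of_notMem
        (fun hx' => absurd hx'.1 (by simpa using hx)) _ }
  refine eLpNorm_le_of_ae_tendsto (F := T) (fun m => (hT m).measurable.aestronglyMeasurable)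
    (fun m => ?_) (.of_forall fun x => ?_)
  · let g : (Fin N → ℝ) → ℂ := fun x => conj (T m x) * (‖T m x‖ ^ (q - 2) : ℝ)
    have hgn : ∀ x, ‖g x‖ = ‖T m x‖ ^ (q - 1) := fun x => (conj_mul_norm_rpow hq _).2
    have hg : IsBddSupp ((m : ℝ) ^ (q - 1)) m g :=
      { measurable := (continuous_conj.measurable.comp (hT m).measurable).mul
          (measurable_ofReal.comp ((hT m).measurable.norm.pow_const _))
        norm_le := fun x => by
          rw [hgn]
          exact Real.rpow_le_rpow (norm_nonneg _) ((hT m).norm_le x) (by linarith)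
        eq_zero := fun x hx => by simp [g, (hT m).eq_zero x hx] }
    have hhg : ∀ x, h x * g x = ((‖T m x‖ ^ q : ℝ) : ℂ) := fun x => by
      rw [← (conj_mul_norm_rpow hq (T m x)).1]
      by_cases hx : x ∈ S m
      · simp only [g, T, Set.indicator_of_mem hx]
      · simp [g, T, Set.indicator_of_notMem hx]
    have hgs : ∀ x, ‖g x‖ ^ s⁻¹ = ‖T m x‖ ^ q := fun x => by
      rw [hgn, ← Real.rpow_mul (norm_nonneg _)]
      congr 1
      rw [hq_def]
      field_simp
      ring
    have key := H _ _ g hg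
    have hJ : 0 ≤ ∫ x, ‖T m x‖ ^ q := integral_nonneg fun x => by positivity
    simp only [hhg, hgs] at key
    rw [integral_complex_ofReal, norm_real, Real.norm_of_nonneg hJ] at key
    rw [(hT m).eLpNorm_eq (one_pos.trans hq), hq_def, inv_inv]
    exact ENNReal.ofReal_le_ofReal (rpow_one_sub_le hJ hM key hs₁)
  · obtain ⟨n, hn⟩ := exists_nat_ge (max ‖x‖ ‖h x‖)
    refine tendsto_const_nhds.congr' ?_
    filter_upwards [eventually_ge_atTop n] with m hm
    have hm' : max ‖x‖ ‖h x‖ ≤ m := hn.trans (by exact_mod_cast hm)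
    have hx : x ∈ S m :=
      ⟨by simpa using (le_max_left _ _).trans hm', (le_max_right _ _).trans hm'⟩
    exact (Set.indicator_of_mem hx h).symm

lemma memM_of_formBdd (hW : LocallyIntegrable W volume) (h2 : MemM W 2 2) {a s : ℝ} (ha : 0 < a)
    (hs₀ : 0 < s) (hs₁ : s < 1) (h : FormBdd W a s) :
    MemM W (ENNReal.ofReal a⁻¹) (ENNReal.ofReal (1 - s)⁻¹) := by
  obtain ⟨_, _, h2⟩ := h2
  obtain ⟨K, hK, h⟩ := h
  have hbdd : ∀ {C R : ℝ} {f : (Fin N → ℝ) → ℂ}, IsBddSupp C R f →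
      eLpNorm (convW W f) (ENNReal.ofReal (1 - s)⁻¹) ≤
        ENNReal.ofReal K * eLpNorm f (ENNReal.ofReal a⁻¹) := by
    intro C R f hf
    have hm := aestronglyMeasurable_convW hW hf.measurable
    rw [hf.eLpNorm_eq (inv_pos.2 ha), ← ENNReal.ofReal_mul hK, inv_inv,
      eLpNorm_congr_ae hm.ae_eq_mk]
    refine eLpNorm_le_of_forall_integral_mul_le hm.stronglyMeasurable_mk.measurable
      (by positivity) hs₀ hs₁ fun C' R' g hg => ?_
    convert h _ _ _ _ f g hf hg using 2
    rw [kernelForm_eq_integral_convW hW hf hg]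
    refine integral_congr_ae ?_
    filter_upwards [hm.ae_eq_mk] with x hx
    rw [hx]
  refine ⟨K, hK, fun f => ⟨(h2 f).1, ?_⟩⟩
  let F : ℕ → (Fin N → ℝ) → ℂ := fun n => (closedBall 0 n).indicator f
  obtain ⟨C, hC⟩ : ∃ C, ∀ x, ‖f x‖ ≤ C := ⟨_, f.toBoundedContinuousFunction.norm_coe_le_norm⟩
  have hF : ∀ n : ℕ, IsBddSupp C n (F n) := fun n =>
    { measurable := f.continuous.measurable.indicator measurableSet_closedBall
      norm_le := fun x => (norm_indicator_le_norm_self _ _).trans (hC x)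
      eq_zero := fun x hx => Set.indicator_of_notMem (by simpa using hx) _ }
  refine eLpNorm_le_of_ae_tendsto (F := fun n => convW W (F n))
    (fun n => aestronglyMeasurable_convW hW (hF n).measurable) (fun n => (hbdd (hF n)).trans ?_) ?_
  · gcongr
    exact eLpNorm_indicator_le _
  · filter_upwards [(h2 f).1] with x hx
    refine tendsto_integral_of_dominated_convergence _ (fun n => ?_) hx.norm
      (fun n => .of_forall fun y => ?_) (.of_forall fun y => ?_)
    · have : (fun y => (W (x - y) : ℂ) * F n y) =
          (closedBall 0 (n : ℝ)).indicator fun y => (W (x - y) : ℂ) * f y := by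
        ext y
        by_cases hy : y ∈ closedBall (0 : Fin N → ℝ) n
        · simp only [F, Set.indicator_of_mem hy]
        · simp only [F, Set.indicator_of_notMem hy, mul_zero]
      rw [this]
      exact hx.aestronglyMeasurable.indicator measurableSet_closedBall
    · rw [norm_mul, norm_mul]
      gcongr
      exact norm_indicator_le_norm_self _ _
    · refine Tendsto.const_mul _ (tendsto_const_nhds.congr' ?_)
      obtain ⟨n, hn⟩ := exists_nat_ge ‖y‖
      filter_upwards [eventually_ge_atTop n] with m hm
      refine (Set.indicator_of_mem ?_ _).symm
      simpa using hn.trans (by exact_mod_cast hm : (n : ℝ) ≤ m)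

end Converse

/-- If `a ≤ b ≤ c` with `a < c`, then `b` is a convex combination of `a` and `c`. -/
lemma exists_interp_eq {a b c : ℝ} (hab : a ≤ b) (hbc : b ≤ c) (hac : a < c) :
    ∃ t ∈ Set.Icc (0 : ℝ) 1, (1 - t) * a + t * c = b := by
  have h : 0 < c - a := sub_pos.2 hac
  refine ⟨(b - a) / (c - a), ⟨by apply div_nonneg <;> linarith, ?_⟩, ?_⟩
  · rw [div_le_one h]
    linarith
  · field_simp
    ring

/-- Let `N ≥ 4` and let `W` be locally integrable, even, not a.e. zero, and
satisfy condition `(W_N)`.  Then `W ∈ M_{N/(N-2),2}(ℝ^N)`, `W ∈ M_{N/(N-2),N/2}(ℝ^N)` and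
`W ∈ M_{2,N/2}(ℝ^N)`. -/
theorem statement10 {N : ℕ} (hN : 4 ≤ N)
    (W : (Fin N → ℝ) → ℝ) (hWloc : MeasureTheory.LocallyIntegrable W volume)
    (hWeven : ∀ᵐ x : Fin N → ℝ, W (-x) = W x)
    (hWne : ¬ (∀ᵐ x : Fin N → ℝ, W x = 0))
    (hWn : CondWn W) :
    MemM W (ENNReal.ofReal ((N : ℝ) / ((N : ℝ) - 2))) 2 ∧
    MemM W (ENNReal.ofReal ((N : ℝ) / ((N : ℝ) - 2))) (ENNReal.ofReal ((N : ℝ) / 2)) ∧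
    MemM W 2 (ENNReal.ofReal ((N : ℝ) / 2)) := by
  obtain ⟨p₁, p₂, p₃, p₄, q₁, q₂, q₃, q₄, s₁, s₂, -, -, hp₃, hp₄, -, -, -, -, -, -, hcond, -,
    h22, -, -, h3, h4, -⟩ := hWn
  obtain ⟨hp₄', -, -, hp₃', -, -, -, -, -, -, -, hq₃, hq₄⟩ := hcond (by omega)
  have hN' : (4 : ℝ) ≤ N := by exact_mod_cast hN
  set t : ℝ := 2 / N with ht
  have ht0 : 0 < t := by positivity
  have ht2 : t ≤ 1 / 2 := by rw [ht, div_le_div_iff₀] <;> linarith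
  have hNt : (N : ℝ) / (N - 2) = (1 - t)⁻¹ := by
    rw [ht]
    have : (N : ℝ) - 2 ≠ 0 := by linarith
    field_simp
  have hN2 : (N : ℝ) / 2 = (1 - (1 - t))⁻¹ := by rw [ht]; simp
  have hN2' : (N : ℝ) / 2 = t⁻¹ := by rw [ht]; simp
  have hp₄0 : 0 < p₄ := by linarith
  have hp₃0 : 0 < p₃ := by linarith
  have hq₃1 : 1 < q₃ := by linarith
  have hq₄1 : 1 < q₄ := by linarith
  have ha₄ : 1 - t < p₄⁻¹ := by
    rw [hNt] at hp₄'
    exact (lt_inv_comm₀ hp₄0 (by linarith)).1 hp₄'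
  have hb₄ : q₄⁻¹ < t := by
    rw [hN2'] at hq₄
    exact inv_lt_of_inv_lt₀ ht0 hq₄
  have hb₃ : q₃⁻¹ < t := by
    rw [hN2'] at hq₃
    exact inv_lt_of_inv_lt₀ ht0 hq₃
  have ha₃ : p₃⁻¹ ≤ 1 / 2 := by
    rw [one_div]
    exact inv_anti₀ two_pos hp₃'
  have ha₃0 : 0 < p₃⁻¹ := inv_pos.2 hp₃0
  have two_eq : (2 : ℝ≥0∞) = ENNReal.ofReal 2 := by simp
  have D : FormBdd W (1 / 2) (1 / 2) := by
    have := formBdd_of_memM hWloc two_pos one_lt_two (by simpa using h22 : MemM W _ _)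
    norm_num at this ⊢
    exact this
  have P₃ := formBdd_of_memM hWloc hp₃0 hq₃1 h3
  have P₄ := formBdd_of_memM hWloc hp₄0 hq₄1 h4
  have hdiag : FormBdd W (1 - t) (1 - t) := by
    have hmid := P₄.interp (t := 1 / 2) hWloc (by linarith) (by linarith) (by linarith)
      (by linarith) (by norm_num) (P₄.symm hWeven)
    rw [show (1 - 1 / 2) * (1 - q₄⁻¹) + 1 / 2 * p₄⁻¹ = (1 - 1 / 2) * p₄⁻¹ + 1 / 2 * (1 - q₄⁻¹) by
      ring] at hmid
    obtain ⟨θ, hθ, hθe⟩ := exists_interp_eq (a := 1 / 2) (b := 1 - t)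
      (c := (1 - 1 / 2) * p₄⁻¹ + 1 / 2 * (1 - q₄⁻¹)) (by linarith) (by linarith) (by linarith)
    have := D.interp hWloc (by norm_num) (by linarith) (by norm_num) (by linarith) hθ hmid
    rwa [hθe] at this
  have hhalf : FormBdd W (1 / 2) (1 - t) := by
    obtain ⟨θ, hθ, hθe⟩ := exists_interp_eq (a := p₃⁻¹) (b := 1 / 2) (c := p₄⁻¹) ha₃ (by linarith)
      (by linarith)
    have hP := P₃.interp hWloc ha₃0 (by linarith) (by linarith) (by linarith) hθ P₄
    rw [hθe] at hP
    have hlt : 1 - t < (1 - θ) * (1 - q₃⁻¹) + θ * (1 - q₄⁻¹) := by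
      have := interp_pos (b₀ := t - q₃⁻¹) (b₁ := t - q₄⁻¹) (by linarith) (by linarith) hθ
      linarith
    obtain ⟨η, hη, hηe⟩ := exists_interp_eq (a := 1 / 2) (b := 1 - t)
      (c := (1 - θ) * (1 - q₃⁻¹) + θ * (1 - q₄⁻¹)) (by linarith) hlt.le (by linarith)
    have := D.interp hWloc (by norm_num) (by norm_num) (by norm_num) (by linarith) hη hP
    rwa [hηe, show (1 - η) * (1 / 2) + η * (1 / 2) = (1 / 2 : ℝ) by ring] at this
  refine ⟨?_, ?_, ?_⟩
  · have := memM_of_formBdd hWloc h22 (by linarith) (by norm_num) (by norm_num) (hhalf.symm hWeven)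
    rw [hNt, two_eq]
    norm_num at this ⊢
    exact this
  · rw [hNt, hN2]
    exact memM_of_formBdd hWloc h22 (by linarith) (by linarith) (by linarith) hdiag
  · have := memM_of_formBdd hWloc h22 (by norm_num) (by linarith) (by linarith) hhalf
    rw [hN2, two_eq]
    norm_num at this ⊢
    exact this
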